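/- Let f : X → Y be a dominant morphism of integral schemes of finite type over a field k, and let e = dim X − dim Y. Then for every point y ∈ f(X), every irreducible component of the fiber X_y = f^{-1}(y) has dimension ≥ e. -/

import Mathlib

theorem ringKrullDim_eq_of_faithfulSMul_of_isIntegral (R S : Type*) [CommRing R] [CommRing S]
    [Algebra R S] [FaithfulSMul R S] [Algebra.IsIntegral R S] :
    ringKrullDim R = ringKrullDim S := by
  apply le_antisymm
  · refine iSup_le fun l ↦ ?_
    obtain ⟨P, hP, hPl⟩ := (inferInstance : Nonempty (l.head.asIdeal.primesOver S))
    obtain ⟨L, hL, -⟩ := Ideal.exists_ltSeries_of_hasGoingUp l P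
    exact hL ▸ Order.LTSeries.length_le_krullDim L
  · exact Order.krullDim_le_of_strictMono (PrimeSpectrum.comap (algebraMap R S))
      fun _ _ h ↦ Ideal.IsIntegral.comap_lt_comap h

theorem Algebra.trdeg_eq_of_isAlgebraic (R : Type*) {S A : Type*} [CommRing R] [CommRing S]
    [CommRing A] [Algebra R S] [Algebra S A] [Algebra R A] [IsScalarTower R S A] [Nontrivial R]
    [IsDomain A] [FaithfulSMul R S] [FaithfulSMul S A] [Algebra.IsAlgebraic S A] :
    (trdeg R S).toENat = (trdeg R A).toENat := by
  have := congrArg Cardinal.toENat (lift_trdeg_add_eq R S A)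
  simpa [trdeg_eq_zero] using this

theorem Algebra.toENat_trdeg_mvPolynomial (k : Type*) [Field k] (s : ℕ) :
    (trdeg k (MvPolynomial (Fin s) k)).toENat = s := by
  simp [MvPolynomial.trdeg_of_isDomain]

theorem ringKrullDim_eq_trdeg (k A : Type*) [Field k] [CommRing A] [IsDomain A] [Algebra k A]
    [Algebra.FiniteType k A] : ringKrullDim A = (Algebra.trdeg k A).toENat := by
  obtain ⟨s, g, hg, hg'⟩ := exists_integral_inj_algHom_of_fg k A
  algebraize [g.toRingHom]
  have : FaithfulSMul (MvPolynomial (Fin s) k) A :=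
    (faithfulSMul_iff_algebraMap_injective _ _).mpr hg
  rw [← ringKrullDim_eq_of_faithfulSMul_of_isIntegral (MvPolynomial (Fin s) k) A,
    ← Algebra.trdeg_eq_of_isAlgebraic k (S := MvPolynomial (Fin s) k),
    Algebra.toENat_trdeg_mvPolynomial]
  simp

open Polynomial in
theorem PowerBasis.coeff_zero_dvd_pow_of_gen_mul_eq {R K E : Type*} [CommRing R] [IsDomain R]
    [IsIntegrallyClosed R] [Field K] [Algebra R K] [IsFractionRing R K] [Field E] [Algebra K E]
    [Algebra R E] [IsScalarTower R K E] (pb : PowerBasis K E) {p : R[X]}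
    (hp : minpoly K pb.gen = p.map (algebraMap R K)) {z : E} (hz : IsIntegral R z) {a : R}
    (h : pb.gen * z = algebraMap R E a) : p.coeff 0 ∣ a ^ Module.finrank K E := by
  have : FiniteDimensional K E := pb.finite
  obtain ⟨b, hb⟩ := IsIntegrallyClosed.isIntegral_iff.mp (Algebra.isIntegral_norm K hz)
  have hN := Algebra.PowerBasis.norm_gen_eq_coeff_zero_minpoly pb
  rw [hp, coeff_map] at hN
  refine ⟨(-1) ^ pb.dim * b, IsFractionRing.injective R K ?_⟩
  have := congrArg (Algebra.norm K) h
  rw [map_mul, hN, ← hb, IsScalarTower.algebraMap_apply R K E, Algebra.norm_algebraMap] at this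
  rw [map_pow, ← this]
  simp only [map_mul, map_pow, map_neg, map_one]
  ring

open IntermediateField in
theorem coeff_zero_minpoly_dvd_pow_of_isFractionRing {R A : Type*} (K L : Type*) [CommRing R]
    [IsDomain R] [IsIntegrallyClosed R] [CommRing A] [IsDomain A] [Algebra R A]
    [FaithfulSMul R A] [Algebra.IsIntegral R A] [Field K] [Algebra R K] [IsFractionRing R K]
    [Field L] [Algebra A L] [IsFractionRing A L] [Algebra K L] [Algebra R L]
    [IsScalarTower R K L] [IsScalarTower R A L] {f : A} {a : R} (h : f ∣ algebraMap R A a) :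
    ∃ n, (minpoly R f).coeff 0 ∣ a ^ n := by
  obtain ⟨g, hg⟩ := h
  rcases eq_or_ne f 0 with rfl | hf
  · have : a = 0 := by simpa using hg
    exact ⟨1, by simp [this]⟩
  have hx : algebraMap A L f ≠ 0 := by simpa using hf
  have hint (t : A) : IsIntegral R (algebraMap A L t) :=
    (Algebra.IsIntegral.isIntegral t).map (IsScalarTower.toAlgHom R A L)
  have hxK : IsIntegral K (algebraMap A L f) := (hint f).tower_top
  let pb := adjoin.powerBasis hxK
  have hgen : algebraMap K⟮algebraMap A L f⟯ L pb.gen = algebraMap A L f := by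
    rw [adjoin.powerBasis_gen hxK]
    exact AdjoinSimple.algebraMap_gen K _
  have hgen0 : pb.gen ≠ 0 := fun h ↦ hx (by rw [← hgen, h, map_zero])
  have : IsScalarTower R K⟮algebraMap A L f⟯ L := .of_algebraMap_eq fun r ↦ by
    rw [IsScalarTower.algebraMap_apply R K L,
      IsScalarTower.algebraMap_apply R K K⟮algebraMap A L f⟯,
      ← IsScalarTower.algebraMap_apply K K⟮algebraMap A L f⟯ L]
  have hz : algebraMap K⟮algebraMap A L f⟯ L (algebraMap R _ a / pb.gen) = algebraMap A L g := by
    rw [map_div₀, hgen, div_eq_iff hx, ← IsScalarTower.algebraMap_apply R _ L,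
      IsScalarTower.algebraMap_apply R A L, hg, map_mul, mul_comm]
  refine ⟨_, pb.coeff_zero_dvd_pow_of_gen_mul_eq (z := algebraMap R _ a / pb.gen) ?_ ?_
    (mul_div_cancel₀ _ hgen0)⟩
  · rw [adjoin.powerBasis_gen hxK, minpoly_gen K,
      ← minpoly.isIntegrallyClosed_eq_field_fractions K L (Algebra.IsIntegral.isIntegral f)]
  · rw [← isIntegral_algHom_iff (IsScalarTower.toAlgHom R K⟮algebraMap A L f⟯ L)
      (algebraMap K⟮algebraMap A L f⟯ L).injective, IsScalarTower.coe_toAlgHom', hz]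
    exact hint g

theorem coeff_zero_minpoly_dvd_pow {R A : Type*} [CommRing R] [IsDomain R] [IsIntegrallyClosed R]
    [CommRing A] [IsDomain A] [Algebra R A] [FaithfulSMul R A] [Algebra.IsIntegral R A]
    {f : A} {a : R} (h : f ∣ algebraMap R A a) :
    ∃ n, (minpoly R f).coeff 0 ∣ a ^ n := by
  have : FaithfulSMul R (FractionRing A) := .trans R A (FractionRing A)
  let : Algebra (FractionRing R) (FractionRing A) := FractionRing.liftAlgebra R (FractionRing A)
  have : IsScalarTower R (FractionRing R) (FractionRing A) :=
    FractionRing.isScalarTower_liftAlgebra R (FractionRing A)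
  exact coeff_zero_minpoly_dvd_pow_of_isFractionRing (FractionRing R) (FractionRing A) h

open Polynomial in
theorem minpoly.coeff_zero_ne_zero_of_isDomain {R A : Type*} [CommRing R] [IsDomain R]
    [CommRing A] [IsDomain A] [Algebra R A] {f : A} (hf : IsIntegral R f) (hf0 : f ≠ 0) :
    (minpoly R f).coeff 0 ≠ 0 := by
  intro h
  have := eq_of_monic_of_associated monic_X (minpoly.monic hf)
    (irreducible_X.associated_of_dvd (minpoly.irreducible hf) (X_dvd_iff.mpr h))
  exact hf0 (by simpa [← this] using minpoly.aeval R f)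

theorem MvPolynomial.card_le_toENat_trdeg_quotient_add_one {k σ : Type*} [Field k] [Fintype σ]
    {q : Ideal (MvPolynomial σ k)} (hq : q ≠ ⊤) {c : MvPolynomial σ k} (hc : c ≠ 0)
    (hcq : c ∈ q) (h : ∀ a ∈ q, ∃ n, c ∣ a ^ n) :
    (Fintype.card σ : ℕ∞) ≤ (Algebra.trdeg k (MvPolynomial σ k ⧸ q)).toENat + 1 := by
  classical
  obtain ⟨i, hi⟩ : c.vars.Nonempty := by
    rw [Finset.nonempty_iff_ne_empty, ne_eq, vars_eq_empty_iff_eq_C]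
    intro hC
    refine hq (q.eq_top_of_isUnit_mem hcq ?_)
    rw [hC, ne_eq, map_eq_zero] at hc
    rw [hC]
    exact (IsUnit.mk0 _ hc).map C
  rw [mem_vars_iff_degreeOf_ne_zero] at hi
  have hind : AlgebraicIndependent k
      fun j : {j // j ≠ i} ↦ Ideal.Quotient.mk q (X (j : σ)) := by
    refine (injective_iff_map_eq_zero _).mpr fun p hp ↦ ?_
    have haeval : aeval (fun j : {j // j ≠ i} ↦ Ideal.Quotient.mk q (X (j : σ))) =
        (Ideal.Quotient.mkₐ k q).comp (rename Subtype.val) := by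
      ext j; simp
    rw [haeval, AlgHom.comp_apply, Ideal.Quotient.mkₐ_eq_mk, Ideal.Quotient.eq_zero_iff_mem] at hp
    by_contra hp0
    have hr : rename Subtype.val p ≠ (0 : MvPolynomial σ k) :=
      (map_ne_zero_iff _ (rename_injective _ Subtype.val_injective)).mpr hp0
    obtain ⟨n, d, hd⟩ := h _ hp
    have hd0 : d ≠ 0 := by
      rintro rfl
      exact pow_ne_zero n hr (by simpa using hd)
    have hri : (rename Subtype.val p : MvPolynomial σ k).degreeOf i = 0 := by
      by_contra hri
      rw [← ne_eq, ← mem_vars_iff_degreeOf_ne_zero] at hri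
      obtain ⟨j, -, hj⟩ := Finset.mem_image.mp (vars_rename _ p hri)
      exact j.2 hj
    have := congrArg (degreeOf i) hd
    rw [degreeOf_pow_eq _ _ _ hr, degreeOf_mul_eq hc hd0, hri] at this
    omega
  have hcard := OrderHomClass.mono Cardinal.toENat hind.lift_cardinalMk_le_trdeg
  rw [Cardinal.toENat_lift, Cardinal.toENat_lift, Cardinal.mk_fintype, Cardinal.toENat_nat,
    Fintype.card_subtype_compl, Fintype.card_subtype_eq] at hcard
  calc (Fintype.card σ : ℕ∞) = ((Fintype.card σ - 1 : ℕ) : ℕ∞) + 1 := by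
        have : 0 < Fintype.card σ := Fintype.card_pos_iff.mpr ⟨i⟩
        exact_mod_cast (by omega : Fintype.card σ = Fintype.card σ - 1 + 1)
    _ ≤ _ := by gcongr

theorem Algebra.toENat_trdeg_le_quotient_add_one_of_dvd_pow (k : Type*) {A : Type*} [Field k]
    [CommRing A] [IsDomain A] [Algebra k A] [Algebra.FiniteType k A] {P : Ideal A} [P.IsPrime]
    {f : A} (hf : f ≠ 0) (hfP : f ∈ P) (h : ∀ a ∈ P, ∃ n, f ∣ a ^ n) :
    (trdeg k A).toENat ≤ (trdeg k (A ⧸ P)).toENat + 1 := by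
  obtain ⟨s, g, hg, hg'⟩ := exists_integral_inj_algHom_of_fg k A
  algebraize [g.toRingHom]
  have : FaithfulSMul (MvPolynomial (Fin s) k) A :=
    (faithfulSMul_iff_algebraMap_injective _ _).mpr hg
  have : Algebra.IsIntegral (MvPolynomial (Fin s) k) A := ‹_›
  have : IsScalarTower k (MvPolynomial (Fin s) k) A :=
    .of_algebraMap_eq fun r ↦ (g.commutes r).symm
  have hint : IsIntegral (MvPolynomial (Fin s) k) f := Algebra.IsIntegral.isIntegral f
  rw [← Algebra.trdeg_eq_of_isAlgebraic k (S := MvPolynomial (Fin s) k),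
    Algebra.toENat_trdeg_mvPolynomial,
    ← Algebra.trdeg_eq_of_isAlgebraic k
      (S := MvPolynomial (Fin s) k ⧸ P.under (MvPolynomial (Fin s) k))]
  have := MvPolynomial.card_le_toENat_trdeg_quotient_add_one (q := P.under (MvPolynomial (Fin s) k))
    (Ideal.IsPrime.ne_top inferInstance) (minpoly.coeff_zero_ne_zero_of_isDomain hint hf) ?_ ?_
  · simpa using this
  · rw [Ideal.under_def, Ideal.mem_comap]
    obtain ⟨d, hd⟩ := (minpoly (MvPolynomial (Fin s) k) f).X_dvd_sub_C
    have := congrArg (Polynomial.aeval f) hd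
    rw [map_sub, minpoly.aeval, Polynomial.aeval_C, map_mul, Polynomial.aeval_X, zero_sub] at this
    rw [← neg_mem_iff, this]
    exact P.mul_mem_right _ hfP
  · intro a ha
    obtain ⟨n, hn⟩ := h _ ha
    rw [← map_pow] at hn
    obtain ⟨m, hm⟩ := coeff_zero_minpoly_dvd_pow hn
    exact ⟨n * m, by rwa [pow_mul]⟩

theorem Ideal.exists_notMem_forall_mul_pow_mem {A : Type*} [CommRing A] [IsNoetherianRing A]
    {I P : Ideal A} (hP : P ∈ I.minimalPrimes) : ∃ g ∉ P, ∀ a ∈ P, ∃ n, (a * g) ^ n ∈ I := by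
  have hfin := I.finite_minimalPrimes_of_isNoetherianRing A
  have hPp : P.IsPrime := hP.1.1
  have hle : ¬ (hfin.toFinset.erase P).inf id ≤ P := by
    rw [hPp.inf_le']
    rintro ⟨Q, hQ, hQP⟩
    rw [Finset.mem_erase, hfin.mem_toFinset] at hQ
    exact hQ.1 (le_antisymm hQP (hP.2 hQ.2.1 hQP))
  obtain ⟨g, hg, hgP⟩ := SetLike.not_le_iff_exists.mp hle
  refine ⟨g, hgP, fun a ha ↦ ?_⟩
  change a * g ∈ I.radical
  rw [← Ideal.sInf_minimalPrimes, Submodule.mem_sInf]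
  intro Q hQ
  rcases eq_or_ne Q P with rfl | hne
  · exact Ideal.mul_mem_right _ Q ha
  · rw [Submodule.mem_finsetInf] at hg
    exact Ideal.mul_mem_left Q _ (hg Q (Finset.mem_erase.mpr ⟨hne, hfin.mem_toFinset.mpr hQ⟩))

theorem Algebra.toENat_trdeg_le_quotient_add_one (k : Type*) {A : Type*} [Field k]
    [CommRing A] [IsDomain A] [Algebra k A] [Algebra.FiniteType k A] {P : Ideal A}
    {f : A} (hf : f ≠ 0) (hP : P ∈ (Ideal.span {f}).minimalPrimes) :
    (trdeg k A).toENat ≤ (trdeg k (A ⧸ P)).toENat + 1 := by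
  have : IsNoetherianRing A := Algebra.FiniteType.isNoetherianRing k A
  have hPp : P.IsPrime := hP.1.1
  obtain ⟨g, hgP, hg⟩ := Ideal.exists_notMem_forall_mul_pow_mem hP
  let B := Localization.Away g
  have hg0 : g ≠ 0 := fun h ↦ hgP (h ▸ P.zero_mem)
  have hM : Submonoid.powers g ≤ nonZeroDivisors A :=
    powers_le_nonZeroDivisors_of_noZeroDivisors hg0
  have : IsDomain B := IsLocalization.isDomain_localization hM
  have hinj : Function.Injective (algebraMap A B) := IsLocalization.injective B hM
  have : FaithfulSMul A B := (faithfulSMul_iff_algebraMap_injective _ _).mpr hinj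
  have : Algebra.IsAlgebraic A B := IsLocalization.isAlgebraic B (Submonoid.powers g)
  have : Algebra.FiniteType k B :=
    .trans ‹_› (IsLocalization.finiteType_of_monoid_fg (Submonoid.powers g) B)
  have hdisj := (Ideal.disjoint_powers_iff_notMem_of_isPrime (I := P) g).mpr hgP
  let Q := P.map (algebraMap A B)
  have : Q.IsPrime := IsLocalization.isPrime_of_isPrime_disjoint (.powers g) B P hPp hdisj
  have : Q.LiesOver P :=
    ⟨(IsLocalization.under_map_of_isPrime_disjoint (.powers g) B hPp hdisj).symm⟩
  have hunit : ∀ s : Submonoid.powers g, IsUnit (algebraMap A B s) := IsLocalization.map_units B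
  have : Algebra.IsAlgebraic (A ⧸ P) (B ⧸ Q) := by
    refine ⟨fun x ↦ ?_⟩
    obtain ⟨b, rfl⟩ := Ideal.Quotient.mk_surjective x
    obtain ⟨⟨a, s⟩, has⟩ := IsLocalization.surj (Submonoid.powers g) b
    have hs : (s : A) ∉ P := fun h ↦ Set.disjoint_left.mp hdisj s.2 h
    refine ⟨.C (Ideal.Quotient.mk P s) * .X - .C (Ideal.Quotient.mk P a), fun h ↦ hs ?_, ?_⟩
    · have := congrArg (Polynomial.coeff · 1) h
      simpa [Polynomial.coeff_C_succ, Ideal.Quotient.eq_zero_iff_mem] using this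
    · rw [map_sub, map_mul, Polynomial.aeval_C, Polynomial.aeval_X, Polynomial.aeval_C,
        Ideal.Quotient.algebraMap_mk_of_liesOver, Ideal.Quotient.algebraMap_mk_of_liesOver,
        ← map_mul, mul_comm, has, sub_self]
  rw [Algebra.trdeg_eq_of_isAlgebraic k (S := A) (A := B),
    Algebra.trdeg_eq_of_isAlgebraic k (S := A ⧸ P) (A := B ⧸ Q)]
  refine Algebra.toENat_trdeg_le_quotient_add_one_of_dvd_pow k
    (f := algebraMap A B f) ((map_ne_zero_iff _ hinj).mpr hf) ?_ fun b hb ↦ ?_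
  · exact Ideal.mem_map_of_mem _ (hP.1.2 (Ideal.mem_span_singleton_self f))
  · obtain ⟨⟨a, s⟩, has⟩ := (IsLocalization.mem_map_algebraMap_iff (.powers g) B).mp hb
    obtain ⟨n, hn⟩ := hg a a.2
    rw [Ideal.mem_span_singleton] at hn
    refine ⟨n, ?_⟩
    have := map_dvd (algebraMap A B) hn
    rw [map_pow, map_mul, ← has, mul_assoc, mul_pow] at this
    exact (((hunit s).mul (hunit ⟨g, Submonoid.mem_powers g⟩)).pow n).dvd_mul_right.mp this

theorem Order.height_add_height_le_of_strictMono {α β : Type*} [Preorder α] [PartialOrder β]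
    {f : α → β} (hf : StrictMono f) {b : β} (hb : ∀ x, b ≤ f x) (x : α) :
    height b + height x ≤ height (f x) := by
  suffices H : ∀ (n : ℕ) (x : α), n ≤ height x → height b + n ≤ height (f x) by
    rcases eq_or_ne (height x) ⊤ with h | h
    · have : height (f x) = ⊤ := ENat.eq_top_iff_forall_ge.mpr fun n ↦
        le_add_self.trans (H n x (h ▸ le_top))
      rw [this]
      exact le_top
    · lift height x to ℕ using h with n hn
      exact H n x hn.le
  intro n
  induction n with
  | zero => exact fun x _ ↦ by simpa using height_mono (hb x)
  | succ n ih =>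
    intro x hx
    obtain ⟨p, hp, hpn⟩ := exists_series_of_le_height x hx
    have hlt : p.eraseLast.last < x := hp ▸ p.eraseLast_last_rel_last (by omega)
    have hle : (n : ℕ∞) ≤ height p.eraseLast.last := by
      simpa [hpn] using length_le_height_last (p := p.eraseLast)
    calc height b + (n + 1 : ℕ) = (height b + n) + 1 := by push_cast; rw [add_assoc]
      _ ≤ height (f p.eraseLast.last) + 1 := by gcongr; exact ih _ hle
      _ ≤ height (f x) := height_add_one_le (hf hlt)

theorem PrimeSpectrum.strictMono_comap_quotientMk {A : Type*} [CommRing A] (I : Ideal A) :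
    StrictMono (comap (Ideal.Quotient.mk I)) :=
  Monotone.strictMono_of_injective (fun _ _ h ↦ Ideal.comap_mono h)
    (comap_injective_of_surjective _ Ideal.Quotient.mk_surjective)

theorem PrimeSpectrum.le_comap_quotientMk {A : Type*} [CommRing A] (Q : PrimeSpectrum A)
    (x : PrimeSpectrum (A ⧸ Q.asIdeal)) : Q ≤ comap (Ideal.Quotient.mk Q.asIdeal) x := by
  intro a ha
  rw [comap_asIdeal, Ideal.mem_comap, Ideal.Quotient.eq_zero_iff_mem.mpr ha]
  exact x.asIdeal.zero_mem

theorem Ideal.height_add_height_quotient_le {A : Type*} [CommRing A] {P Q : Ideal A}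
    [P.IsPrime] [Q.IsPrime] (h : Q ≤ P) [(P.map (Ideal.Quotient.mk Q)).IsPrime] :
    Q.height + (P.map (Ideal.Quotient.mk Q)).height ≤ P.height := by
  have := Order.height_add_height_le_of_strictMono
    (PrimeSpectrum.strictMono_comap_quotientMk Q)
    (PrimeSpectrum.le_comap_quotientMk ⟨Q, ‹_›⟩) ⟨P.map (Ideal.Quotient.mk Q), ‹_›⟩
  simp_rw [← PrimeSpectrum.height_eq_orderHeight] at this
  have hc : (P.map (Ideal.Quotient.mk Q)).comap (Ideal.Quotient.mk Q) = P := by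
    rw [Ideal.comap_map_of_surjective' _ Ideal.Quotient.mk_surjective, Ideal.mk_ker,
      sup_eq_left.mpr h]
  simpa [hc] using this

theorem Ideal.height_add_ringKrullDim_quotient_le {A : Type*} [CommRing A] (Q : Ideal A)
    [Q.IsPrime] : Q.height + ringKrullDim (A ⧸ Q) ≤ ringKrullDim A := by
  have : Nontrivial (A ⧸ Q) := Ideal.Quotient.nontrivial_iff.mpr (Ideal.IsPrime.ne_top ‹_›)
  simp only [ringKrullDim, Order.krullDim_eq_iSup_height (α := PrimeSpectrum (A ⧸ Q))]
  rw [← WithBot.coe_iSup (OrderTop.bddAbove _), ← WithBot.coe_add, ENat.add_iSup,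
    WithBot.coe_iSup (OrderTop.bddAbove _)]
  refine iSup_le fun x ↦ ?_
  have := Order.height_add_height_le_of_strictMono
    (PrimeSpectrum.strictMono_comap_quotientMk Q)
    (PrimeSpectrum.le_comap_quotientMk ⟨Q, ‹_›⟩) x
  rw [← PrimeSpectrum.height_eq_orderHeight ⟨Q, ‹_›⟩] at this
  exact (WithBot.coe_le_coe.mpr this).trans (Order.height_le_krullDim _)

theorem Algebra.toENat_trdeg_le_add_of_height_le (k : Type*) [Field k] (n : ℕ) :
    ∀ {A : Type*} [CommRing A] [IsDomain A] [Algebra k A] [Algebra.FiniteType k A] (P : Ideal A)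
      [P.IsPrime], P.height ≤ n → (trdeg k A).toENat ≤ n + (trdeg k (A ⧸ P)).toENat := by
  have hbot : ∀ {A : Type _} [CommRing A] [IsDomain A] [Algebra k A] (n : ℕ),
      (trdeg k A).toENat ≤ n + (trdeg k (A ⧸ (⊥ : Ideal A))).toENat := fun {A} _ _ _ n ↦ by
    rw [(AlgEquiv.quotientBot k A).trdeg_eq]
    exact le_add_self
  induction n with
  | zero =>
    intro A _ _ _ _ P _ hP
    obtain rfl : P = ⊥ := by
      simpa [Ideal.height_eq_zero_iff, IsDomain.minimalPrimes_eq_singleton_bot] using hP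
    exact hbot 0
  | succ n ih =>
    intro A _ _ _ _ P _ hP
    rcases eq_or_ne P ⊥ with rfl | hP0
    · exact hbot (n + 1)
    have : IsNoetherianRing A := Algebra.FiniteType.isNoetherianRing k A
    obtain ⟨f, hfP, hf⟩ := Submodule.exists_mem_ne_zero_of_ne_bot hP0
    obtain ⟨Q, hQ, hQP⟩ := Ideal.exists_minimalPrimes_le
      ((Ideal.span_singleton_le_iff_mem P).mpr hfP)
    have : Q.IsPrime := hQ.1.1
    have hQ0 : 1 ≤ Q.height := by
      rw [Order.one_le_iff_ne_zero, ne_eq, Ideal.height_eq_zero_iff,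
        IsDomain.minimalPrimes_eq_singleton_bot]
      rintro rfl
      exact hf (hQ.1.2 (Ideal.mem_span_singleton_self f))
    have : (P.map (Ideal.Quotient.mk Q)).IsPrime :=
      Ideal.map_isPrime_of_surjective Ideal.Quotient.mk_surjective (by rwa [Ideal.mk_ker])
    have hle : (P.map (Ideal.Quotient.mk Q)).height ≤ n := by
      rw [← ENat.add_le_add_iff_right ENat.one_ne_top]
      calc (P.map (Ideal.Quotient.mk Q)).height + 1
        _ ≤ Q.height + (P.map (Ideal.Quotient.mk Q)).height := by rw [add_comm]; gcongr
        _ ≤ P.height := Ideal.height_add_height_quotient_le hQP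
        _ ≤ n + 1 := by exact_mod_cast hP
    calc (trdeg k A).toENat ≤ (trdeg k (A ⧸ Q)).toENat + 1 :=
          toENat_trdeg_le_quotient_add_one k hf hQ
      _ ≤ n + (trdeg k ((A ⧸ Q) ⧸ P.map (Ideal.Quotient.mk Q))).toENat + 1 := by
        gcongr; exact ih _ hle
      _ = (n + 1 : ℕ) + (trdeg k (A ⧸ P)).toENat := by
        have : trdeg k ((A ⧸ Q) ⧸ P.map (Ideal.Quotient.mk Q)) = trdeg k (A ⧸ P) :=
          (DoubleQuot.quotQuotEquivQuotOfLEₐ k hQP).trdeg_eq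
        rw [this]
        push_cast
        ring

theorem Algebra.toENat_trdeg_le_height_add (k : Type*) {A : Type*} [Field k]
    [CommRing A] [IsDomain A] [Algebra k A] [Algebra.FiniteType k A] (P : Ideal A) [P.IsPrime] :
    (trdeg k A).toENat ≤ P.height + (trdeg k (A ⧸ P)).toENat := by
  have : IsNoetherianRing A := Algebra.FiniteType.isNoetherianRing k A
  obtain ⟨n, hn⟩ := ENat.ne_top_iff_exists.mp (P.height_ne_top (Ideal.IsPrime.ne_top ‹_›))
  rw [← hn]
  exact toENat_trdeg_le_add_of_height_le k n P hn.ge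

theorem Algebra.toENat_trdeg_add_eq (R S A : Type*) [CommRing R] [CommRing S] [CommRing A]
    [Algebra R S] [Algebra S A] [Algebra R A] [IsScalarTower R S A] [Nontrivial R]
    [IsDomain A] [FaithfulSMul R S] [FaithfulSMul S A] :
    (trdeg R S).toENat + (trdeg S A).toENat = (trdeg R A).toENat := by
  simpa using congrArg Cardinal.toENat (lift_trdeg_add_eq R S A)

theorem Algebra.toENat_trdeg_le_of_injective {R A B : Type*} [CommRing R] [CommRing A]
    [CommRing B] [Algebra R A] [Algebra R B] (f : A →ₐ[R] B) (hf : Function.Injective f) :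
    (trdeg R A).toENat ≤ (trdeg R B).toENat := by
  simpa using OrderHomClass.mono Cardinal.toENat (lift_trdeg_le_of_injective f hf)

theorem Ideal.height_le_height_of_forall_liesOver {A B : Type*} [CommRing A] [IsNoetherianRing A]
    [CommRing B] [IsNoetherianRing B] [Algebra A B] (p : Ideal A) [p.IsPrime] (P : Ideal B)
    [P.IsPrime] [P.LiesOver p]
    (hP : ∀ Q : Ideal B, Q.IsPrime → Q.LiesOver p → Q ≤ P → Q = P) :
    P.height ≤ p.height := by
  have hle : p.map (algebraMap A B) ≤ P := Ideal.map_le_iff_le_comap.mpr (P.over_def p).le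
  have hc : (P.map (Ideal.Quotient.mk (p.map (algebraMap A B)))).comap
      (Ideal.Quotient.mk _) = P := by
    rw [Ideal.comap_map_of_surjective' _ Ideal.Quotient.mk_surjective, Ideal.mk_ker,
      sup_eq_left.mpr hle]
  have : (P.map (Ideal.Quotient.mk (p.map (algebraMap A B)))).IsPrime :=
    Ideal.map_isPrime_of_surjective Ideal.Quotient.mk_surjective (by rwa [Ideal.mk_ker])
  have h0 : (P.map (Ideal.Quotient.mk (p.map (algebraMap A B)))).height = 0 := by
    rw [Ideal.height_eq_zero_iff]
    refine ⟨⟨this, bot_le⟩, fun Q ⟨hQ, _⟩ hQP ↦ ?_⟩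
    have hQP' : Q.comap (Ideal.Quotient.mk _) ≤ P := (Ideal.comap_mono hQP).trans hc.le
    have hover : (Q.comap (Ideal.Quotient.mk (p.map (algebraMap A B)))).LiesOver p := by
      refine ⟨le_antisymm (fun a ha ↦ ?_) ((Ideal.comap_mono hQP').trans (P.over_def p).ge)⟩
      rw [Ideal.under_def, Ideal.mem_comap, Ideal.mem_comap,
        Ideal.Quotient.eq_zero_iff_mem.mpr (Ideal.mem_map_of_mem _ ha)]
      exact Q.zero_mem
    rw [← hP _ (hQ.comap _) hover hQP',
      Ideal.map_comap_of_surjective _ Ideal.Quotient.mk_surjective]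
  simpa [h0] using Ideal.height_le_height_add_of_liesOver p P

theorem PrimeSpectrum.ringKrullDim_quotient_le_of_isInducing {F X : Type*} [CommRing F]
    [TopologicalSpace X] {f : PrimeSpectrum F → X} (hf : Topology.IsInducing f)
    (P : PrimeSpectrum F) {T : Set X} (hT : ∀ Q, P ≤ Q → f Q ∈ T) :
    ringKrullDim (F ⧸ P.asIdeal) ≤ topologicalKrullDim T := by
  let q := comap (Ideal.Quotient.mk P.asIdeal)
  have hq : Topology.IsInducing q := (isClosedEmbedding_comap_of_surjective _ _
    Ideal.Quotient.mk_surjective).isInducing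
  rw [← topologicalKrullDim_eq_ringKrullDim]
  exact Topology.IsInducing.topologicalKrullDim_le
    (f := fun x ↦ ⟨f (q x), hT _ (le_comap_quotientMk P x)⟩)
    (Topology.IsInducing.subtypeVal.of_comp_iff.mp (hf.comp hq))

theorem faithfulSMul_of_field (K D : Type*) [Field K] [CommRing D] [Nontrivial D] [Algebra K D] :
    FaithfulSMul K D := inferInstance

theorem ringKrullDim_le_topologicalKrullDim_add_ringKrullDim (k : Type*) {A B : Type*} [Field k]
    [CommRing A] [IsDomain A] [CommRing B] [IsDomain B] [Algebra k A] [Algebra k B] [Algebra A B]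
    [IsScalarTower k A B] [Algebra.FiniteType k A] [Algebra.FiniteType k B]
    (p : PrimeSpectrum A) (P : PrimeSpectrum B) (hPp : PrimeSpectrum.comap (algebraMap A B) P = p)
    (hP : ∀ Q ≤ P, PrimeSpectrum.comap (algebraMap A B) Q = p → Q = P) :
    ringKrullDim B ≤ topologicalKrullDim
      {Q : PrimeSpectrum B | P ≤ Q ∧ PrimeSpectrum.comap (algebraMap A B) Q = p} +
        ringKrullDim A := by
  have : IsNoetherianRing A := Algebra.FiniteType.isNoetherianRing k A
  have : IsNoetherianRing B := Algebra.FiniteType.isNoetherianRing k B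
  have : Algebra.FiniteType A B := .of_restrictScalars_finiteType k A B
  let e := PrimeSpectrum.preimageHomeomorphFiber A B p
  obtain ⟨P', hP'⟩ : ∃ P', (e.symm P').1 = P :=
    ⟨e ⟨P, hPp⟩, congrArg Subtype.val (e.symm_apply_apply _)⟩
  have hP'' : P'.asIdeal.comap
      (Algebra.TensorProduct.includeRight : B →ₐ[A] p.asIdeal.Fiber B) = P.asIdeal :=
    congrArg PrimeSpectrum.asIdeal hP'
  let D := p.asIdeal.Fiber B ⧸ P'.asIdeal
  have : IsDomain D := Ideal.Quotient.isDomain _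
  have : Algebra.FiniteType p.asIdeal.ResidueField D := inferInstance
  have : FaithfulSMul p.asIdeal.ResidueField D :=
    faithfulSMul_of_field p.asIdeal.ResidueField D
  have hD : ringKrullDim D = (Algebra.trdeg p.asIdeal.ResidueField D).toENat :=
    ringKrullDim_eq_trdeg p.asIdeal.ResidueField D
  have hDle : ringKrullDim D ≤ topologicalKrullDim
      {Q : PrimeSpectrum B | P ≤ Q ∧ PrimeSpectrum.comap (algebraMap A B) Q = p} := by
    refine PrimeSpectrum.ringKrullDim_quotient_le_of_isInducing
      (Topology.IsInducing.subtypeVal.comp e.symm.isInducing) P' fun Q hQ ↦ ⟨?_, (e.symm Q).2⟩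
    rw [← hP']
    exact (PrimeSpectrum.preimageOrderIsoFiber A B p).symm.monotone hQ
  have htr : (Algebra.trdeg k (B ⧸ P.asIdeal)).toENat ≤
      (Algebra.trdeg k (A ⧸ p.asIdeal)).toENat +
        (Algebra.trdeg p.asIdeal.ResidueField D).toENat := by
    rw [Algebra.trdeg_eq_of_isAlgebraic k (S := A ⧸ p.asIdeal) (A := p.asIdeal.ResidueField),
      Algebra.toENat_trdeg_add_eq]
    exact Algebra.toENat_trdeg_le_of_injective (Ideal.quotientMapₐ P'.asIdeal
      ((Algebra.TensorProduct.includeRight : B →ₐ[A] p.asIdeal.Fiber B).restrictScalars k) hP''.ge)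
      (Ideal.quotientMap_injective' (H := hP''.ge) hP''.le)
  have : P.asIdeal.LiesOver p.asIdeal := ⟨congrArg PrimeSpectrum.asIdeal hPp.symm⟩
  have hht : P.asIdeal.height ≤ p.asIdeal.height :=
    Ideal.height_le_height_of_forall_liesOver _ _ fun Q hQ hQp hQP ↦
      congrArg PrimeSpectrum.asIdeal
        (hP ⟨Q, hQ⟩ hQP (PrimeSpectrum.ext (Q.over_def p.asIdeal).symm))
  calc ringKrullDim B = (Algebra.trdeg k B).toENat := ringKrullDim_eq_trdeg k B
    _ ≤ ((p.asIdeal.height + ((Algebra.trdeg k (A ⧸ p.asIdeal)).toENat +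
        (Algebra.trdeg p.asIdeal.ResidueField D).toENat) : ℕ∞) : WithBot ℕ∞) := by
      exact WithBot.coe_le_coe.mpr
        ((Algebra.toENat_trdeg_le_height_add k P.asIdeal).trans (add_le_add hht htr))
    _ = ringKrullDim D + (p.asIdeal.height + ringKrullDim (A ⧸ p.asIdeal)) := by
      rw [hD, ringKrullDim_eq_trdeg k (A ⧸ p.asIdeal), ← add_assoc, add_comm]
      push_cast
      rfl
    _ ≤ _ := by
      gcongr
      exact Ideal.height_add_ringKrullDim_quotient_le _

open AlgebraicGeometry CategoryTheory

/-- The structure homomorphism of the sections over `U` of a scheme over the spectrum of `k`. -/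
noncomputable def AlgebraicGeometry.Scheme.Hom.sectionsStructure {k : Type} [Field k] {X : Scheme}
    (s : X ⟶ Spec (CommRingCat.of k)) (U : X.Opens) : k →+* Γ(X, U) :=
  ((Scheme.ΓSpecIso (CommRingCat.of k)).inv ≫
    s.appLE ⊤ U (le_top.trans_eq s.preimage_top.symm)).hom

lemma AlgebraicGeometry.Scheme.Hom.finiteType_sectionsStructure {k : Type} [Field k] {X : Scheme}
    (s : X ⟶ Spec (CommRingCat.of k)) [LocallyOfFiniteType s] {U : X.Opens}
    (hU : IsAffineOpen U) : (s.sectionsStructure U).FiniteType := by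
  rw [sectionsStructure, CommRingCat.hom_comp]
  exact (s.finiteType_appLE (isAffineOpen_top _) hU (by simp)).comp
    (RingHom.FiniteType.of_surjective _
      (Scheme.ΓSpecIso (CommRingCat.of k)).symm.commRingCatIsoToRingEquiv.surjective)

lemma AlgebraicGeometry.Scheme.Hom.appLE_comp_sectionsStructure {k : Type} [Field k]
    {X Y : Scheme} (f : X ⟶ Y) (s : Y ⟶ Spec (CommRingCat.of k)) {U : X.Opens} {V : Y.Opens}
    (e : U ≤ f ⁻¹ᵁ V) :
    (f.appLE V U e).hom.comp (s.sectionsStructure V) = (f ≫ s).sectionsStructure U := by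
  rw [sectionsStructure, sectionsStructure, ← CommRingCat.hom_comp, Category.assoc,
    Scheme.Hom.appLE_comp_appLE]

lemma AlgebraicGeometry.Scheme.Hom.germ_comp_sectionsStructure {k : Type} [Field k]
    {X : Scheme} (s : X ⟶ Spec (CommRingCat.of k)) (U : X.Opens) (x : X) (hx : x ∈ U) :
    (X.presheaf.germ U x hx).hom.comp (s.sectionsStructure U) =
      (X.presheaf.germ ⊤ x trivial).hom.comp (s.sectionsStructure ⊤) := by
  rw [← X.presheaf.germ_res (homOfLE le_top : U ⟶ ⊤) x hx]
  rw [sectionsStructure, sectionsStructure, ← CommRingCat.hom_comp, ← CommRingCat.hom_comp,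
    Category.assoc, Category.assoc, Scheme.Hom.appLE_map_assoc]

/-- The dimension of an affine open of an integral scheme locally of finite type over a field is
the transcendence degree of the function field. -/
lemma AlgebraicGeometry.ringKrullDim_eq_trdeg_functionField {k : Type} [Field k] {X : Scheme}
    [IsIntegral X] (s : X ⟶ Spec (CommRingCat.of k)) [LocallyOfFiniteType s] {U : X.Opens}
    (hU : IsAffineOpen U) [Nonempty U] :
    ringKrullDim Γ(X, U) =
      letI := ((X.presheaf.germ ⊤ (genericPoint X) trivial).hom.comp
        (s.sectionsStructure ⊤)).toAlgebra
      (Algebra.trdeg k X.functionField).toENat := by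
  let := ((X.presheaf.germ ⊤ (genericPoint X) trivial).hom.comp (s.sectionsStructure ⊤)).toAlgebra
  let := (s.sectionsStructure U).toAlgebra
  have : IsScalarTower k Γ(X, U) X.functionField :=
    .of_algebraMap_eq' (s.germ_comp_sectionsStructure U _ _).symm
  have : Algebra.FiniteType k Γ(X, U) := s.finiteType_sectionsStructure hU
  have := functionField_isFractionRing_of_isAffineOpen X U hU
  have : Algebra.IsAlgebraic Γ(X, U) X.functionField :=
    IsLocalization.isAlgebraic _ (nonZeroDivisors Γ(X, U))
  have : FaithfulSMul Γ(X, U) X.functionField :=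
    (faithfulSMul_iff_algebraMap_injective _ _).2 (X.germToFunctionField_injective U)
  rw [ringKrullDim_eq_trdeg k Γ(X, U),
    Algebra.trdeg_eq_of_isAlgebraic k (S := Γ(X, U)) (A := X.functionField)]

/-- The dimension of an integral scheme locally of finite type over a field is attained on every
nonempty affine open. -/
lemma AlgebraicGeometry.topologicalKrullDim_le_ringKrullDim {k : Type} [Field k] {X : Scheme}
    [IsIntegral X] (s : X ⟶ Spec (CommRingCat.of k)) [LocallyOfFiniteType s] {U : X.Opens}
    (hU : IsAffineOpen U) [Nonempty U] :
    topologicalKrullDim X ≤ ringKrullDim Γ(X, U) := by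
  rw [topologicalKrullDim, Order.krullDim_eq_iSup_coheight]
  refine iSup_le fun T ↦ ?_
  obtain ⟨x, hxT⟩ := T.isIrreducible.nonempty
  obtain ⟨U', hU', hx, -⟩ := exists_isAffineOpen_mem_and_subset (x := x) (U := ⊤) trivial
  have : Nonempty U' := ⟨⟨x, hx⟩⟩
  have hemb := hU'.fromSpec.isOpenEmbedding
  obtain ⟨T', hT'⟩ :=
    (TopologicalSpace.IrreducibleCloseds.orderIsoOfIsOpenEmbedding _ hemb).surjective
      ⟨T, hU'.primeIdealOf ⟨x, hx⟩,
        (congrArg (· ∈ T) (hU'.fromSpec_primeIdealOf ⟨x, hx⟩)).mpr hxT⟩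
  have hT : TopologicalSpace.IrreducibleCloseds.map _ hemb.continuous T' = T :=
    congrArg Subtype.val hT'
  rw [← hT, hemb.coheight_map, ringKrullDim_eq_trdeg_functionField s hU,
    ← ringKrullDim_eq_trdeg_functionField s hU',
    ← PrimeSpectrum.topologicalKrullDim_eq_ringKrullDim]
  exact Order.coheight_le_krullDim T'

lemma AlgebraicGeometry.IsAffineOpen.ringKrullDim_le {X : Scheme} {U : X.Opens}
    (hU : IsAffineOpen U) : ringKrullDim Γ(X, U) ≤ topologicalKrullDim X := by
  rw [← PrimeSpectrum.topologicalKrullDim_eq_ringKrullDim]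
  exact hU.fromSpec.isOpenEmbedding.isInducing.topologicalKrullDim_le

/-- In a subspace that is quasi-sober, an irreducible component is the set of specializations of a
point that is maximal for generization within the subspace. -/
lemma exists_eq_setOf_specializes_of_mem_irreducibleComponents {α : Type*} [TopologicalSpace α]
    [T0Space α] {S : Set α} [QuasiSober S] {Z : Set S} (hZ : Z ∈ irreducibleComponents S) :
    ∃ x : S, Z = {z | x.1 ⤳ z.1} ∧ ∀ x' ∈ S, x' ⤳ x.1 → x' = x := by
  obtain ⟨x, hx⟩ := QuasiSober.sober hZ.1 (isClosed_of_mem_irreducibleComponents Z hZ)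
  have hZx : Z = {z | x.1 ⤳ z.1} := by
    ext z
    rw [← hx.def, ← specializes_iff_mem_closure]
    exact subtype_specializes_iff x z
  refine ⟨x, hZx, fun x' hx' hspec ↦ (hspec.antisymm ?_).eq⟩
  have hle : Z ⊆ closure {⟨x', hx'⟩} := by
    rw [← hx.def]
    exact closure_minimal (Set.singleton_subset_iff.2 (specializes_iff_mem_closure.1
      ((subtype_specializes_iff ⟨x', hx'⟩ x).2 hspec))) isClosed_closure
  have hmem : (⟨x', hx'⟩ : S) ∈ Z := hZ.2 isIrreducible_singleton.closure hle (subset_closure rfl)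
  rwa [hZx] at hmem

/-- Irreducible components of the fibers of a morphism between integral schemes locally of finite
type over a field have at least the expected dimension. -/
lemma AlgebraicGeometry.topologicalKrullDim_le_add_of_mem_irreducibleComponents
    {k : Type} [Field k] {X Y : Scheme} [IsIntegral X] [IsIntegral Y] (f : X ⟶ Y)
    (s : Y ⟶ Spec (CommRingCat.of k)) [LocallyOfFiniteType s] [LocallyOfFiniteType (f ≫ s)]
    (y : Y) {Z : Set (f ⁻¹' {y})} (hZ : Z ∈ irreducibleComponents (f ⁻¹' {y})) :
    topologicalKrullDim X ≤ topologicalKrullDim Z + topologicalKrullDim Y := by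
  have : QuasiSober (f ⁻¹' {y}) := (f.fiberHomeo y).symm.isClosedEmbedding.quasiSober
  obtain ⟨⟨x, rfl⟩, rfl, hmax⟩ := exists_eq_setOf_specializes_of_mem_irreducibleComponents hZ
  obtain ⟨V, hV, hyV, -⟩ := exists_isAffineOpen_mem_and_subset (x := f x) (U := ⊤) trivial
  obtain ⟨U, hU, hxU, hUV⟩ := exists_isAffineOpen_mem_and_subset (x := x) (U := f ⁻¹ᵁ V) hyV
  have : Nonempty U := ⟨⟨x, hxU⟩⟩
  have : Nonempty V := ⟨⟨f x, hyV⟩⟩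
  let := (s.sectionsStructure V).toAlgebra
  let := ((f ≫ s).sectionsStructure U).toAlgebra
  let := (f.appLE V U hUV).hom.toAlgebra
  have : IsScalarTower k Γ(Y, V) Γ(X, U) :=
    .of_algebraMap_eq' (f.appLE_comp_sectionsStructure s hUV).symm
  have : Algebra.FiniteType k Γ(Y, V) := s.finiteType_sectionsStructure hV
  have : Algebra.FiniteType k Γ(X, U) := (f ≫ s).finiteType_sectionsStructure hU
  let P := hU.primeIdealOf ⟨x, hxU⟩
  let p := hV.primeIdealOf ⟨f x, hyV⟩
  have hP : hU.fromSpec P = x := hU.fromSpec_primeIdealOf _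
  have hp : hV.fromSpec p = f x := hV.fromSpec_primeIdealOf _
  have hfrom (Q : PrimeSpectrum Γ(X, U)) :
      f (hU.fromSpec Q) = hV.fromSpec (Q.comap (algebraMap Γ(Y, V) Γ(X, U))) :=
    (congrArg (fun g : Spec Γ(X, U) ⟶ Y ↦ g Q) (hV.SpecMap_appLE_fromSpec f hU hUV)).symm
  have hcomap (Q : PrimeSpectrum Γ(X, U)) (hQ : Q.comap (algebraMap Γ(Y, V) Γ(X, U)) = p) :
      f (hU.fromSpec Q) = f x := by
    rw [hfrom, hQ, hp]
  have hgen (Q Q' : PrimeSpectrum Γ(X, U)) (h : Q ≤ Q') : hU.fromSpec Q ⤳ hU.fromSpec Q' :=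
    ((PrimeSpectrum.le_iff_specializes _ _).1 h).map hU.fromSpec.continuous
  have hind := hU.fromSpec.isOpenEmbedding.isInducing
  have key := ringKrullDim_le_topologicalKrullDim_add_ringKrullDim k p P
    (IsAffineOpen.comap_primeIdealOf_appLE V hV U hU hUV hxU) fun Q hQP hQ ↦
      hU.fromSpec.isOpenEmbedding.injective <|
        (hmax _ (hcomap Q hQ) (hP ▸ hgen Q P hQP)).trans hP.symm
  refine (topologicalKrullDim_le_ringKrullDim (f ≫ s) hU).trans (key.trans ?_)
  refine add_le_add ?_ hV.ringKrullDim_le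
  have hspec (Q : PrimeSpectrum Γ(X, U)) (hQ : P ≤ Q) : x ⤳ hU.fromSpec Q :=
    hP ▸ hgen P Q hQ
  let φ : {Q : PrimeSpectrum Γ(X, U) | P ≤ Q ∧ Q.comap (algebraMap Γ(Y, V) Γ(X, U)) = p} →
      {z : f ⁻¹' {f x} | x ⤳ z.1} := fun Q ↦
    ⟨⟨hU.fromSpec Q.1, hcomap Q.1 Q.2.2⟩, hspec Q.1 Q.2.1⟩
  have hφ : Topology.IsInducing φ := by
    rw [← Topology.IsInducing.subtypeVal.of_comp_iff, ← Topology.IsInducing.subtypeVal.of_comp_iff]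
    exact hind.comp Topology.IsInducing.subtypeVal
  exact hφ.topologicalKrullDim_le

/-- Fiber-dimension lower bound for a dominant morphism f : X → Y of integral schemes of
finite type over a field k: every irreducible component Z of a fiber f⁻¹(y) satisfies
dim Z ≥ dim X − dim Y, i.e. dim X ≤ dim Z + dim Y. -/
theorem stmt_10 {k : Type} [Field k] {X Y : Scheme}
    [IsIntegral X] [IsIntegral Y]
    (sX : X ⟶ Spec (CommRingCat.of k)) (sY : Y ⟶ Spec (CommRingCat.of k))
    [LocallyOfFiniteType sX] [LocallyOfFiniteType sY]
    [CompactSpace X] [CompactSpace Y]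
    (f : X ⟶ Y) (hf : f ≫ sY = sX) (hdom : DenseRange ⇑(f.base))
    (y : Y) (hy : y ∈ Set.range ⇑(f.base))
    (Z : Set (⇑(f.base) ⁻¹' {y})) (hZ : Z ∈ irreducibleComponents (⇑(f.base) ⁻¹' {y})) :
    topologicalKrullDim X ≤ topologicalKrullDim Z + topologicalKrullDim Y := by
  subst hf
  exact topologicalKrullDim_le_add_of_mem_irreducibleComponents f sY y hZ
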